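/- arXiv:1908.10889 — 2 statements merged into one kernel-verified Lean document; each statement's English description precedes it below -/
import Mathlib

section
/- For a real symmetric 3×3 matrix M with trace zero, equality ‖M‖₂² = (2/3)|M|² holds if and only if M has a repeated eigenvalue (two of its three eigenvalues coincide). -/
open scoped Matrix.Norms.L2Operator in
/-- The spectral norm of a Hermitian matrix is the largest absolute value of an eigenvalue. -/
theorem Matrix.IsHermitian.norm_toEuclideanCLM_eq {n : Type*} [Fintype n] [DecidableEq n]
    {M : Matrix n n ℝ} (hM : M.IsHermitian) :
    ‖Matrix.toEuclideanCLM (𝕜 := ℝ) M‖ = ‖hM.eigenvalues‖ := by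
  have h : ‖M‖ = ‖Matrix.diagonal hM.eigenvalues‖ := by
    conv_lhs => rw [hM.spectral_theorem, Unitary.conjStarAlgAut_apply]
    rw [← Unitary.coe_star, CStarRing.norm_mul_coe_unitary, CStarRing.norm_coe_unitary_mul]
    rfl
  rw [← Matrix.l2_opNorm_diagonal, ← h]
  exact Matrix.l2_opNorm_toEuclideanCLM M

/-- The squared Frobenius norm of a Hermitian matrix is the sum of its squared eigenvalues. -/
theorem Matrix.IsHermitian.sum_sq_eq_sum_eigenvalues_sq {n : Type*} [Fintype n] [DecidableEq n]
    {M : Matrix n n ℝ} (hM : M.IsHermitian) :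
    ∑ i, ∑ j, (M i j) ^ 2 = ∑ i, hM.eigenvalues i ^ 2 := by
  have h₁ : (M * M).trace = ∑ i, ∑ j, (M i j) ^ 2 := by
    simp only [Matrix.trace, Matrix.diag, Matrix.mul_apply]
    refine Finset.sum_congr rfl fun i _ => Finset.sum_congr rfl fun j _ => ?_
    rw [sq, ← hM.apply i j, star_trivial]
  have h₂ : (M * M).trace = ∑ i, hM.eigenvalues i ^ 2 := by
    conv_lhs => rw [hM.spectral_theorem, ← map_mul, Unitary.conjStarAlgAut_apply,
      Matrix.trace_mul_cycle, Unitary.coe_star_mul_self, one_mul, Matrix.diagonal_mul_diagonal,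
      Matrix.trace_diagonal]
    simp [sq]
  rw [← h₁, h₂]

/-- For three reals with sum zero, the largest square is two thirds of the sum of the squares
exactly when two of them coincide. -/
theorem norm_sq_eq_two_thirds_sum_sq_iff (v : Fin 3 → ℝ) (hv : ∑ i, v i = 0) :
    ‖v‖ ^ 2 = (2 / 3) * ∑ i, v i ^ 2 ↔ ∃ i j : Fin 3, i ≠ j ∧ v i = v j := by
  have hle (i : Fin 3) : v i ^ 2 ≤ ‖v‖ ^ 2 := by
    rw [← sq_abs, ← Real.norm_eq_abs]
    gcongr
    exact norm_le_pi_norm v i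
  obtain ⟨k, hk⟩ : ∃ k, ‖v‖ ^ 2 = v k ^ 2 := by
    obtain ⟨k, hk⟩ := Finite.exists_max fun i => ‖v i‖
    refine ⟨k, ?_⟩
    rw [le_antisymm ((pi_norm_le_iff_of_nonneg (norm_nonneg _)).2 hk) (norm_le_pi_norm v k),
      Real.norm_eq_abs, sq_abs]
  rw [Fin.sum_univ_three] at hv ⊢
  have h0 := hle 0
  have h1 := hle 1
  have h2 := hle 2
  have e : v 2 = - v 0 - v 1 := by linarith
  constructor
  · intro h
    rw [hk, e] at h
    fin_cases k
    · refine ⟨1, 2, by decide, ?_⟩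
      have : (v 0 + 2 * v 1) ^ 2 = 0 := by simp only [Fin.zero_eta] at h; linarith
      have := pow_eq_zero_iff (two_ne_zero) |>.1 this
      linarith
    · refine ⟨0, 2, by decide, ?_⟩
      have : (2 * v 0 + v 1) ^ 2 = 0 := by simp only [Fin.mk_one] at h; linarith
      have := pow_eq_zero_iff (two_ne_zero) |>.1 this
      linarith
    · refine ⟨0, 1, by decide, ?_⟩
      have : (v 0 - v 1) ^ 2 = 0 := by simp only [Fin.reduceFinMk] at h; rw [e] at h; linarith
      have := pow_eq_zero_iff (two_ne_zero) |>.1 this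
      linarith
  · rintro ⟨i, j, hij, h⟩
    have key : (v 0 - v 1) * (v 0 - v 2) * (v 1 - v 2) = 0 := by
      fin_cases i <;> fin_cases j <;> first | exact absurd rfl hij | skip
      all_goals simp only [Fin.zero_eta, Fin.mk_one, Fin.reduceFinMk] at h; rw [h]; ring
    rw [hk] at h0 h1 h2 ⊢
    rw [e] at h2 key ⊢
    simp only [mul_eq_zero] at key
    rcases key with (key | key) | key
    · have e' : v 0 = v 1 := by linarith
      fin_cases k <;> simp only [Fin.zero_eta, Fin.mk_one, Fin.reduceFinMk, e, e'] at * <;>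
        nlinarith [sq_nonneg (v 1)]
    · have e' : v 1 = -2 * v 0 := by linarith
      fin_cases k <;> simp only [Fin.zero_eta, Fin.mk_one, Fin.reduceFinMk, e, e'] at * <;>
        nlinarith [sq_nonneg (v 0)]
    · have e' : v 0 = -2 * v 1 := by linarith
      fin_cases k <;> simp only [Fin.zero_eta, Fin.mk_one, Fin.reduceFinMk, e, e'] at * <;>
        nlinarith [sq_nonneg (v 1)]

/-- For a real symmetric (Hermitian) 3×3 matrix `M` with trace zero, equality
`‖M‖₂² = (2/3)|M|²` between the squared spectral norm and two thirds of the squared Frobenius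
norm holds if and only if two of the three eigenvalues of `M` coincide. -/
theorem stmt1 (M : Matrix (Fin 3) (Fin 3) ℝ) (hM : M.IsHermitian) (htr : M.trace = 0) :
    ‖Matrix.toEuclideanCLM (𝕜 := ℝ) M‖ ^ 2 = (2 / 3) * ∑ i, ∑ j, (M i j) ^ 2 ↔
      ∃ i j : Fin 3, i ≠ j ∧ hM.eigenvalues i = hM.eigenvalues j := by
  rw [hM.norm_toEuclideanCLM_eq, hM.sum_sq_eq_sum_eigenvalues_sq]
  refine norm_sq_eq_two_thirds_sum_sq_iff _ ?_
  simpa [htr] using hM.trace_eq_sum_eigenvalues.symm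
end

section
/- Fix a ∈ (0, √6/6) and define η_a(x) = min{1, (1−√6·a)/(1−√6·x)} for x ∈ [0, √6/6). Then for every Q ∈ 𝒬_phy, the matrix η_a(d(Q))·Q belongs to 𝒬_phy and d(η_a(d(Q))·Q) = max{a, d(Q)}; in particular, η_a(d(Q))·Q = Q whenever d(Q) ≥ a, and d(η_a(d(Q))·Q) = a whenever d(Q) ≤ a. -/
open Matrix

/-- `𝒬`: the set of real symmetric traceless 3×3 matrices. -/
def QSpace : Set (Matrix (Fin 3) (Fin 3) ℝ) := {Q | Q.IsSymm ∧ Q.trace = 0}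

/-- `𝒬_phy`: physical Q-tensors, i.e. symmetric traceless matrices whose eigenvalues all lie
in `[-1/3, 2/3]`. -/
def QPhy : Set (Matrix (Fin 3) (Fin 3) ℝ) :=
  {Q | Q ∈ QSpace ∧ spectrum ℝ Q ⊆ Set.Icc (-(1:ℝ)/3) (2/3)}

/-- The Frobenius distance between two matrices. -/
noncomputable def frobDist (X Y : Matrix (Fin 3) (Fin 3) ℝ) : ℝ :=
  Real.sqrt (∑ i, ∑ j, (X i j - Y i j) ^ 2)

/-- `d(Q)`: the distance, in Frobenius norm, from `Q` to the complement of `𝒬_phy` within `𝒬`. -/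
noncomputable def dQ (Q : Matrix (Fin 3) (Fin 3) ℝ) : ℝ :=
  sInf ((fun Q' => frobDist Q Q') '' (QSpace \ QPhy))

/-- The cutoff function `η_a(x) = min{1, (1 - √6 a)/(1 - √6 x)}`. -/
noncomputable def etaA (a x : ℝ) : ℝ := min 1 ((1 - Real.sqrt 6 * a) / (1 - Real.sqrt 6 * x))

theorem mem_spectrum_iff_exists_mulVec {Q : Matrix (Fin 3) (Fin 3) ℝ} {μ : ℝ} :
    μ ∈ spectrum ℝ Q ↔ ∃ v, v ≠ 0 ∧ Q *ᵥ v = μ • v := by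
  rw [spectrum.mem_iff, Matrix.isUnit_iff_isUnit_det, isUnit_iff_ne_zero, not_not,
    ← Matrix.exists_mulVec_eq_zero_iff]
  refine exists_congr fun v => and_congr_right fun _ => ?_
  rw [Matrix.sub_mulVec, sub_eq_zero, Matrix.algebraMap_eq_diagonal]
  have h : Matrix.diagonal (algebraMap ℝ (Fin 3 → ℝ) μ) *ᵥ v = μ • v := by
    ext i
    simp [Matrix.mulVec_diagonal]
  rw [h, eq_comm]

theorem dotProduct_self_pos {v : Fin 3 → ℝ} (hv : v ≠ 0) : 0 < v ⬝ᵥ v := by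
  have h := Matrix.dotProduct_star_self_pos_iff.2 hv
  simpa using h

theorem posSemidef_sub_of_forall_le {Q : Matrix (Fin 3) (Fin 3) ℝ} (hQ : Q.IsSymm) {m : ℝ}
    (hm : ∀ μ ∈ spectrum ℝ Q, m ≤ μ) : (Q - algebraMap ℝ _ m).PosSemidef := by
  refine Matrix.posSemidef_iff_isHermitian_and_spectrum_nonneg.2 ⟨?_, ?_⟩
  · rw [Matrix.IsHermitian, Matrix.conjTranspose_eq_transpose_of_trivial, Matrix.transpose_sub,
      Matrix.algebraMap_eq_diagonal, Matrix.diagonal_transpose, hQ.eq]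
  · rw [← spectrum.sub_singleton_eq]
    rintro _ ⟨μ, hμ, _, rfl, rfl⟩
    exact sub_nonneg.2 (hm μ hμ)

theorem le_dotProduct_mulVec_of_forall_le {Q : Matrix (Fin 3) (Fin 3) ℝ} (hQ : Q.IsSymm) {m : ℝ}
    (hm : ∀ μ ∈ spectrum ℝ Q, m ≤ μ) (x : Fin 3 → ℝ) : m * (x ⬝ᵥ x) ≤ x ⬝ᵥ (Q *ᵥ x) := by
  have h := (posSemidef_sub_of_forall_le hQ hm).dotProduct_mulVec_nonneg x
  have hd : Matrix.diagonal (algebraMap ℝ (Fin 3 → ℝ) m) *ᵥ x = m • x := by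
    ext i
    simp [Matrix.mulVec_diagonal]
  rw [Matrix.sub_mulVec, Matrix.algebraMap_eq_diagonal, hd] at h
  simpa [dotProduct_sub] using h

theorem exists_isLeast_spectrum {Q : Matrix (Fin 3) (Fin 3) ℝ} (hQ : Q.IsSymm) :
    ∃ m, IsLeast (spectrum ℝ Q) m := by
  have hH : Q.IsHermitian := (Matrix.conjTranspose_eq_transpose_of_trivial Q).trans hQ
  rw [hH.spectrum_real_eq_range_eigenvalues]
  obtain ⟨i, hi⟩ := Finite.exists_min hH.eigenvalues
  exact ⟨_, ⟨i, rfl⟩, by rintro _ ⟨j, rfl⟩; exact hi j⟩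

theorem isLeast_spectrum_smul {Q : Matrix (Fin 3) (Fin 3) ℝ} (hQ : Q.IsSymm) {m c : ℝ}
    (hc : 0 ≤ c) (hm : IsLeast (spectrum ℝ Q) m) : IsLeast (spectrum ℝ (c • Q)) (c * m) := by
  constructor
  · obtain ⟨v, hv, h⟩ := mem_spectrum_iff_exists_mulVec.1 hm.1
    exact mem_spectrum_iff_exists_mulVec.2 ⟨v, hv, by rw [Matrix.smul_mulVec, h, smul_smul]⟩
  · intro μ hμ
    obtain ⟨v, hv, h⟩ := mem_spectrum_iff_exists_mulVec.1 hμ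
    have h1 := le_dotProduct_mulVec_of_forall_le hQ hm.2 v
    have h2 : c * (v ⬝ᵥ (Q *ᵥ v)) = μ * (v ⬝ᵥ v) := by
      rw [← smul_eq_mul, ← dotProduct_smul, ← Matrix.smul_mulVec, h, dotProduct_smul, smul_eq_mul]
    have hs := dotProduct_self_pos hv
    refine le_of_mul_le_mul_right ?_ hs
    calc c * m * (v ⬝ᵥ v) = c * (m * (v ⬝ᵥ v)) := by ring
      _ ≤ c * (v ⬝ᵥ (Q *ᵥ v)) := mul_le_mul_of_nonneg_left h1 hc
      _ = μ * (v ⬝ᵥ v) := h2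

theorem mem_QPhy_iff_of_isLeast {Q : Matrix (Fin 3) (Fin 3) ℝ} (hQ : Q ∈ QSpace) {m : ℝ}
    (hm : IsLeast (spectrum ℝ Q) m) : Q ∈ QPhy ↔ -(1 / 3) ≤ m := by
  refine ⟨fun h => by have := (h.2 hm.1).1; linarith, fun h => ⟨hQ, fun μ hμ => ?_⟩⟩
  have hH : Q.IsHermitian := (Matrix.conjTranspose_eq_transpose_of_trivial Q).trans hQ.1
  have hlow : ∀ i, -(1 / 3) ≤ hH.eigenvalues i := fun i =>
    h.trans (hm.2 (hH.spectrum_real_eq_range_eigenvalues ▸ ⟨i, rfl⟩))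
  have htr := hH.trace_eq_sum_eigenvalues
  rw [hQ.2, Fin.sum_univ_three] at htr
  simp only [RCLike.ofReal_real_eq_id, id] at htr
  rw [hH.spectrum_real_eq_range_eigenvalues] at hμ
  obtain ⟨i, rfl⟩ := hμ
  have h0 := hlow 0
  have h1 := hlow 1
  have h2 := hlow 2
  fin_cases i <;> constructor <;> dsimp <;> linarith

theorem trace_sub_algebraMap {Q : Matrix (Fin 3) (Fin 3) ℝ} (hQ : Q ∈ QSpace) (m : ℝ) :
    (Q - algebraMap ℝ _ m).trace = -(3 * m) := by
  rw [Matrix.trace_sub, hQ.2, Matrix.algebraMap_eq_diagonal, Matrix.trace_diagonal]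
  simp

theorem nonpos_of_isLeast_spectrum {Q : Matrix (Fin 3) (Fin 3) ℝ} (hQ : Q ∈ QSpace) {m : ℝ}
    (hm : IsLeast (spectrum ℝ Q) m) : m ≤ 0 := by
  have h := (posSemidef_sub_of_forall_le hQ.1 hm.2).trace_nonneg
  rw [trace_sub_algebraMap hQ] at h
  linarith

theorem eq_zero_of_isLeast_spectrum_zero {Q : Matrix (Fin 3) (Fin 3) ℝ} (hQ : Q ∈ QSpace)
    (hm : IsLeast (spectrum ℝ Q) 0) : Q = 0 := by
  have h := posSemidef_sub_of_forall_le hQ.1 hm.2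
  rw [map_zero, sub_zero] at h
  exact h.trace_eq_zero_iff.1 hQ.2

theorem sq_dotProduct_mulVec_le {A : Matrix (Fin 3) (Fin 3) ℝ} (hA : A.trace = 0)
    (u : Fin 3 → ℝ) :
    (u ⬝ᵥ (A *ᵥ u)) ^ 2 ≤ (∑ i, ∑ j, A i j ^ 2) * (2 / 3 * (u ⬝ᵥ u) ^ 2) := by
  have h := Finset.sum_mul_sq_le_sq_mul_sq (Finset.univ : Finset (Fin 3 × Fin 3))
    (fun p => A p.1 p.2) (fun p => u p.1 * u p.2 - if p.1 = p.2 then (u ⬝ᵥ u) / 3 else 0)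
  rw [Fintype.sum_prod_type, Fintype.sum_prod_type, Fintype.sum_prod_type] at h
  have h1 : u ⬝ᵥ (A *ᵥ u) =
      ∑ i, ∑ j, A i j * (u i * u j - if i = j then (u ⬝ᵥ u) / 3 else 0) := by
    rw [Matrix.trace_fin_three] at hA
    simp [Fin.sum_univ_three, Matrix.mulVec, dotProduct]
    linear_combination (u 0 ^ 2 + u 1 ^ 2 + u 2 ^ 2) / 3 * hA
  have h2 : 2 / 3 * (u ⬝ᵥ u) ^ 2 =
      ∑ i, ∑ j, (u i * u j - if i = j then (u ⬝ᵥ u) / 3 else 0) ^ 2 := by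
    simp [Fin.sum_univ_three, dotProduct]
    ring
  rw [h1, h2]
  exact h

theorem dQ_eq_of_isLeast {Q : Matrix (Fin 3) (Fin 3) ℝ} (hQ : Q ∈ QSpace) {m : ℝ}
    (hm : IsLeast (spectrum ℝ Q) m) (h3 : -(1 / 3) ≤ m) :
    dQ Q = √6 / 2 * (m + 1 / 3) := by
  have h6 : √6 ^ 2 = (6 : ℝ) := Real.sq_sqrt (by norm_num)
  have h6p : 0 < √(6 : ℝ) := by positivity
  obtain ⟨v, hv, hvm⟩ := mem_spectrum_iff_exists_mulVec.1 hm.1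
  have hs := dotProduct_self_pos hv
  have near : ∀ ε > 0, ∃ Q' ∈ QSpace \ QPhy, frobDist Q Q' = √6 / 2 * (m + 1 / 3) + ε := by
    intro ε hε
    set s := v ⬝ᵥ v with hsdef
    have hsv : v 0 * v 0 + v 1 * v 1 + v 2 * v 2 = s := by
      rw [hsdef]; simp [dotProduct, Fin.sum_univ_three]
    set t := 3 / 2 * (m + 1 / 3) + √6 / 2 * ε with ht
    set Q' : Matrix (Fin 3) (Fin 3) ℝ :=
      Q - ((t / s) • Matrix.vecMulVec v v - (t / 3) • (1 : Matrix (Fin 3) (Fin 3) ℝ)) with hQ'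
    have hv' : Q' *ᵥ v = (m - 2 / 3 * t) • v := by
      rw [hQ', Matrix.sub_mulVec, Matrix.sub_mulVec, Matrix.smul_mulVec, Matrix.smul_mulVec,
        hvm, Matrix.one_mulVec, Matrix.vecMulVec_mulVec, ← hsdef]
      ext i
      simp
      field_simp
      ring
    refine ⟨Q', ⟨⟨?_, ?_⟩, fun hP => ?_⟩, ?_⟩
    · rw [hQ', Matrix.IsSymm, Matrix.transpose_sub, Matrix.transpose_sub, Matrix.transpose_smul,
        Matrix.transpose_smul, Matrix.transpose_one, Matrix.transpose_vecMulVec, hQ.1.eq]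
    · rw [hQ', Matrix.trace_sub, Matrix.trace_sub, Matrix.trace_smul, Matrix.trace_smul,
        Matrix.trace_one, Matrix.trace_vecMulVec, ← hsdef, hQ.2]
      simp
      field_simp
      ring
    · have := (hP.2 (mem_spectrum_iff_exists_mulVec.2 ⟨v, hv, hv'⟩)).1
      have : 0 < √6 * ε := by positivity
      linarith
    · have hsum : ∑ i, ∑ j, (Q i j - Q' i j) ^ 2 = (√6 / 2 * (m + 1 / 3) + ε) ^ 2 := by
        have e1 : ∑ i, ∑ j, (Q i j - Q' i j) ^ 2 = 2 / 3 * t ^ 2 := by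
          have e2 : ∑ i, ∑ j, (Q i j - Q' i j) ^ 2 =
              (t / s) ^ 2 * (v 0 * v 0 + v 1 * v 1 + v 2 * v 2) ^ 2
              - 2 * (t / s) * (t / 3) * (v 0 * v 0 + v 1 * v 1 + v 2 * v 2) + t ^ 2 / 3 := by
            simp [hQ', Fin.sum_univ_three, Matrix.vecMulVec_apply]
            ring
          rw [e2, hsv]
          field_simp
          ring
        rw [e1, ht]
        linear_combination (1 / 6 * ε ^ 2 - (m + 1 / 3) ^ 2 / 4) * h6
      rw [frobDist, hsum, Real.sqrt_sq]
      have : 0 ≤ m + 1 / 3 := by linarith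
      positivity
  refine IsGLB.csInf_eq ⟨?_, ?_⟩ ?_
  · rintro _ ⟨Q', ⟨hS, hP⟩, rfl⟩
    obtain ⟨m', hm'⟩ := exists_isLeast_spectrum hS.1
    rw [mem_QPhy_iff_of_isLeast hS hm', not_le] at hP
    obtain ⟨u, hu, hum⟩ := mem_spectrum_iff_exists_mulVec.1 hm'.1
    have hsu := dotProduct_self_pos hu
    have h1 := le_dotProduct_mulVec_of_forall_le hQ.1 hm.2 u
    have h2 := sq_dotProduct_mulVec_le (A := Q - Q')
      (by rw [Matrix.trace_sub, hQ.2, hS.2, sub_zero]) u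
    rw [Matrix.sub_mulVec, hum, dotProduct_sub, dotProduct_smul, smul_eq_mul] at h2
    simp only [Matrix.sub_apply] at h2
    refine Real.le_sqrt_of_sq_le ?_
    have h4 : ((m + 1 / 3) * (u ⬝ᵥ u)) ^ 2 ≤ (u ⬝ᵥ (Q *ᵥ u) - m' * (u ⬝ᵥ u)) ^ 2 := by
      refine pow_le_pow_left₀ (mul_nonneg (by linarith) hsu.le) ?_ 2
      nlinarith
    have h5 := h4.trans h2
    rw [mul_pow, ← mul_assoc] at h5
    have h7 := le_of_mul_le_mul_right h5 (by positivity)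
    rw [mul_pow, div_pow, h6]
    linarith
  · intro b hb
    refine le_of_forall_pos_le_add fun ε hε => ?_
    obtain ⟨Q', h, h'⟩ := near ε hε
    exact h' ▸ hb ⟨Q', h, rfl⟩
  · obtain ⟨Q', h, -⟩ := near 1 one_pos
    exact ⟨_, Q', h, rfl⟩

/-- For `a ∈ (0, √6/6)` and `Q ∈ 𝒬_phy`, the matrix `η_a(d(Q)) Q` belongs to `𝒬_phy` and
`d(η_a(d(Q)) Q) = max{a, d(Q)}`; in particular `η_a(d(Q)) Q = Q` whenever `d(Q) ≥ a`, and
`d(η_a(d(Q)) Q) = a` whenever `d(Q) ≤ a`. -/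
theorem stmt16 (a : ℝ) (ha : a ∈ Set.Ioo (0:ℝ) (Real.sqrt 6 / 6))
    (Q : Matrix (Fin 3) (Fin 3) ℝ) (hQ : Q ∈ QPhy) :
    etaA a (dQ Q) • Q ∈ QPhy ∧
    dQ (etaA a (dQ Q) • Q) = max a (dQ Q) ∧
    (a ≤ dQ Q → etaA a (dQ Q) • Q = Q) ∧
    (dQ Q ≤ a → dQ (etaA a (dQ Q) • Q) = a) := by
  obtain ⟨ha0, ha1⟩ := ha
  have h6 : √6 * √6 = (6 : ℝ) := Real.mul_self_sqrt (by norm_num)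
  have h6p : 0 < √(6 : ℝ) := by positivity
  have hS := hQ.1
  obtain ⟨m, hm⟩ := exists_isLeast_spectrum hS.1
  have h3 := (mem_QPhy_iff_of_isLeast hS hm).1 hQ
  have hm0 := nonpos_of_isLeast_spectrum hS hm
  have hd := dQ_eq_of_isLeast hS hm h3
  have hden : 1 - √6 * dQ Q = -3 * m := by
    rw [hd]; linear_combination (-(m + 1 / 3) / 2) * h6
  have hnum : 0 < 1 - √6 * a := by nlinarith
  have hfix : a ≤ dQ Q → etaA a (dQ Q) • Q = Q := by
    intro hle
    rcases hm0.eq_or_lt with rfl | hlt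
    · rw [eq_zero_of_isLeast_spectrum_zero hS hm, smul_zero]
    · have : 1 ≤ (1 - √6 * a) / (1 - √6 * dQ Q) := by
        rw [one_le_div (by rw [hden]; linarith)]
        nlinarith
      rw [etaA, min_eq_left this, one_smul]
  have hcut : dQ Q ≤ a → etaA a (dQ Q) • Q ∈ QPhy ∧ dQ (etaA a (dQ Q) • Q) = a := by
    intro hle
    have hlt : 0 < -3 * m := by rw [← hden]; nlinarith
    have heta : etaA a (dQ Q) = (1 - √6 * a) / (-3 * m) := by
      rw [etaA, hden, min_eq_right]
      rw [div_le_one hlt, ← hden]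
      nlinarith
    rw [heta]
    have hc : 0 ≤ (1 - √6 * a) / (-3 * m) := by positivity
    have hS' : ((1 - √6 * a) / (-3 * m)) • Q ∈ QSpace :=
      ⟨hS.1.smul _, by rw [Matrix.trace_smul, hS.2, smul_zero]⟩
    have hl := isLeast_spectrum_smul hS.1 hc hm
    have hval : (1 - √6 * a) / (-3 * m) * m = -(1 - √6 * a) / 3 := by
      have : m ≠ 0 := by rintro rfl; simp at hlt
      field_simp
    rw [hval] at hl
    have hge : -(1 / 3) ≤ -(1 - √6 * a) / 3 := by
      have := mul_pos h6p ha0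
      linarith
    refine ⟨(mem_QPhy_iff_of_isLeast hS' hl).2 hge, ?_⟩
    rw [dQ_eq_of_isLeast hS' hl hge]
    linear_combination a / 6 * h6
  refine ⟨?_, ?_, hfix, fun h => (hcut h).2⟩
  · rcases le_total a (dQ Q) with h | h
    · rwa [hfix h]
    · exact (hcut h).1
  · rcases le_total a (dQ Q) with h | h
    · rw [hfix h, max_eq_right h]
    · rw [(hcut h).2, max_eq_left h]
end
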